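/- arXiv:2112.12693 — 2 statements merged into one kernel-verified Lean document; each statement's English description precedes it below -/
import Mathlib

section
/- The action-set side conditions are essential for soundness: let ≲' be the greatest relation closed under the rules [end], [in], [out], [𝒜], [ℬ] with the side conditions act(W) = act(𝒜^p.W') and act(W) = act(ℬ^p.W') removed from rules [𝒜] and [ℬ]. Then for distinct participants p and q, labels ℓ, ℓ', sort S, and T the infinite SISO tree satisfying T = p?ℓ(S).T, the unsound refinement T ≲' q?ℓ'(S).T holds (i.e., the weakened relation 'forgets' the initial q?ℓ' input). -/
/-- A single action of a SISO tree: an input from `p` or an output to `p`,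
with label `l` and payload sort `s`. -/
inductive Act (P L S : Type) : Type
  | inp (p : P) (l : L) (s : S)
  | out (p : P) (l : L) (s : S)

/-- A SISO tree is a possibly infinite sequence of actions; `Seq.nil` is `end`. -/
abbrev SISO (P L S : Type) : Type := Stream'.Seq (Act P L S)

/-- Prepend a finite list of actions to a SISO tree. -/
def prepend {P L S : Type} (A : List (Act P L S)) (W : SISO P L S) : SISO P L S :=
  A.foldr Stream'.Seq.cons W

/-- The (participant, direction) action of a term: `(p, true)` for `p?`, `(p, false)` for `p!`. -/
def actOf {P L S : Type} : Act P L S → P × Bool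
  | Act.inp p _ _ => (p, true)
  | Act.out p _ _ => (p, false)

/-- `act(W)`: the set of input/output actions occurring in the tree `W`. -/
def acts {P L S : Type} (W : SISO P L S) : Set (P × Bool) :=
  { a | ∃ (n : ℕ) (t : Act P L S), W.get? n = some t ∧ actOf t = a }

/-- An `𝒜^p`-context: a nonempty finite sequence of input actions from participants `q ≠ p`. -/
def ACtx {P L S : Type} (p : P) (A : List (Act P L S)) : Prop :=
  A ≠ [] ∧ ∀ t ∈ A, ∃ q l s, t = Act.inp q l s ∧ q ≠ p

/-- A `ℬ^p`-context: a nonempty finite sequence of actions in which every output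
is to a participant `q ≠ p`. -/
def BCtx {P L S : Type} (p : P) (B : List (Act P L S)) : Prop :=
  B ≠ [] ∧ ∀ t ∈ B, ∀ q l s, t = Act.out q l s → q ≠ p

/-- One step of the tree refinement rules `[end]`, `[in]`, `[out]`, `[𝒜]`, `[ℬ]`,
with coinductive premises taken from the relation `R`. -/
inductive Step {P L S : Type} (le : S → S → Prop)
    (R : SISO P L S → SISO P L S → Prop) : SISO P L S → SISO P L S → Prop
  | end_ : Step le R Stream'.Seq.nil Stream'.Seq.nil
  | inp {p : P} {l : L} {s s' : S} {W W' : SISO P L S} :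
      le s' s → R W W' →
      Step le R (Stream'.Seq.cons (Act.inp p l s) W) (Stream'.Seq.cons (Act.inp p l s') W')
  | out {p : P} {l : L} {s s' : S} {W W' : SISO P L S} :
      le s s' → R W W' →
      Step le R (Stream'.Seq.cons (Act.out p l s) W) (Stream'.Seq.cons (Act.out p l s') W')
  | ctxA {p : P} {l : L} {s s' : S} {W W' : SISO P L S} {A : List (Act P L S)} :
      le s' s → ACtx p A → R W (prepend A W') → acts W = acts (prepend A W') →
      Step le R (Stream'.Seq.cons (Act.inp p l s) W)
        (prepend A (Stream'.Seq.cons (Act.inp p l s') W'))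
  | ctxB {p : P} {l : L} {s s' : S} {W W' : SISO P L S} {B : List (Act P L S)} :
      le s s' → BCtx p B → R W (prepend B W') → acts W = acts (prepend B W') →
      Step le R (Stream'.Seq.cons (Act.out p l s) W)
        (prepend B (Stream'.Seq.cons (Act.out p l s') W'))

/-- The tree refinement relation `≲`: the greatest relation closed under the rules,
i.e. the union of all post-fixpoints of `Step le`. -/
def Refines {P L S : Type} (le : S → S → Prop) (W W' : SISO P L S) : Prop :=
  ∃ R : SISO P L S → SISO P L S → Prop,
    (∀ a b, R a b → Step le R a b) ∧ R W W'

/-- One step of the weakened refinement rules, with the action-set side conditions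
removed from rules `[𝒜]` and `[ℬ]`. -/
inductive Step' {P L S : Type} (le : S → S → Prop)
    (R : SISO P L S → SISO P L S → Prop) : SISO P L S → SISO P L S → Prop
  | end_ : Step' le R Stream'.Seq.nil Stream'.Seq.nil
  | inp {p : P} {l : L} {s s' : S} {W W' : SISO P L S} :
      le s' s → R W W' →
      Step' le R (Stream'.Seq.cons (Act.inp p l s) W) (Stream'.Seq.cons (Act.inp p l s') W')
  | out {p : P} {l : L} {s s' : S} {W W' : SISO P L S} :
      le s s' → R W W' →
      Step' le R (Stream'.Seq.cons (Act.out p l s) W) (Stream'.Seq.cons (Act.out p l s') W')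
  | ctxA {p : P} {l : L} {s s' : S} {W W' : SISO P L S} {A : List (Act P L S)} :
      le s' s → ACtx p A → R W (prepend A W') →
      Step' le R (Stream'.Seq.cons (Act.inp p l s) W)
        (prepend A (Stream'.Seq.cons (Act.inp p l s') W'))
  | ctxB {p : P} {l : L} {s s' : S} {W W' : SISO P L S} {B : List (Act P L S)} :
      le s s' → BCtx p B → R W (prepend B W') →
      Step' le R (Stream'.Seq.cons (Act.out p l s) W)
        (prepend B (Stream'.Seq.cons (Act.out p l s') W'))

/-- The weakened refinement relation `≲'`. -/
def Refines' {P L S : Type} (le : S → S → Prop) (W W' : SISO P L S) : Prop :=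
  ∃ R : SISO P L S → SISO P L S → Prop,
    (∀ a b, R a b → Step' le R a b) ∧ R W W'

/-- A constant stream, viewed as a sequence, unfolds to its head followed by itself. -/
theorem Stream'.Seq.ofStream_const_eq_cons {α : Type*} (a : α) :
    Stream'.Seq.ofStream (Stream'.const a) =
      Stream'.Seq.cons a (Stream'.Seq.ofStream (Stream'.const a)) := by
  rw [← Stream'.Seq.ofStream_cons, ← Stream'.const_eq]

theorem stmt8 {P L S : Type} (le : S → S → Prop) (hrefl : ∀ s : S, le s s)
    (p q : P) (hpq : p ≠ q) (l l' : L) (s : S) :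
    Refines' le
      (Stream'.Seq.ofStream (Stream'.const (Act.inp p l s)))
      (Stream'.Seq.cons (Act.inp q l' s)
        (Stream'.Seq.ofStream (Stream'.const (Act.inp p l s)))) := by
  set T := Stream'.Seq.ofStream (Stream'.const (Act.inp p l s))
  have unfold_T : T = Stream'.Seq.cons (Act.inp p l s) T :=
    Stream'.Seq.ofStream_const_eq_cons _
  refine ⟨fun a b => a = T ∧ b = Stream'.Seq.cons (Act.inp q l' s) T, ?_, rfl, rfl⟩
  rintro a b ⟨rfl, rfl⟩
  have hA : ACtx p [(Act.inp q l' s : Act P L S)] := by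
    refine ⟨by simp, fun t ht => ⟨q, l', s, by simpa using ht, hpq.symm⟩⟩
  have step := Step'.ctxA (l := l) (W := T) (W' := T)
    (R := fun a b => a = T ∧ b = Stream'.Seq.cons (Act.inp q l' s) T)
    (hrefl s) hA ⟨rfl, rfl⟩
  rw [← unfold_T] at step
  exact step
end

section
/- Double buffering optimisation: let s and t be distinct participants, 'ready' and 'copy' labels, S a sort, and let T' be the infinite SISO tree satisfying T' = s!ready(S).s?copy(S).t?ready(S).t!copy(S).T' (the unfolding of μx.s!ready.s?copy.t?ready.t!copy.x). Then s!ready(S).T' ≲ T', i.e., the optimised type that sends two ready messages up front refines the original. -/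
theorem acts_cons {P L S : Type} (x : Act P L S) (W : SISO P L S) :
    acts (Stream'.Seq.cons x W) = insert (actOf x) (acts W) := by
  ext a
  constructor
  · rintro ⟨n, u, hu, rfl⟩
    cases n with
    | zero =>
      rw [Stream'.Seq.get?_cons_zero] at hu
      cases hu
      exact Set.mem_insert _ _
    | succ n => exact Or.inr ⟨n, u, hu, rfl⟩
  · rintro (rfl | ⟨n, u, hu, rfl⟩)
    · exact ⟨0, x, rfl, rfl⟩
    · exact ⟨n + 1, u, hu, rfl⟩

/-- A periodic tree is unfolded by prepending one period. -/
theorem ofStream_cycle_eq_prepend {P L S : Type} (l : List (Act P L S)) (h : l ≠ []) :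
    (Stream'.Seq.ofStream (Stream'.cycle l h) : SISO P L S) =
      prepend l (Stream'.Seq.ofStream (Stream'.cycle l h)) := by
  have ofStream_append (l : List (Act P L S)) (w : Stream' (Act P L S)) :
      (Stream'.Seq.ofStream (l ++ₛ w) : SISO P L S) = prepend l (Stream'.Seq.ofStream w) := by
    induction l with
    | nil => rfl
    | cons x l ih =>
      rw [Stream'.cons_append_stream, Stream'.Seq.ofStream_cons, ih]
      rfl
  conv_lhs => rw [Stream'.cycle_eq l h]
  exact ofStream_append l _

/-- The pairs of trees reached when an output to `s` is anticipated before the loop `T`,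
whose body is `s!ready.s?copy.t?ready.t!copy`. -/
inductive DoubleBuffering {P L S : Type} (s t : P) (ready copy : L) (v : S) (T : SISO P L S) :
    SISO P L S → SISO P L S → Prop
  | start : DoubleBuffering s t ready copy v T (Stream'.Seq.cons (Act.out s ready v) T) T
  | ready_out : DoubleBuffering s t ready copy v T T
      (prepend [Act.inp s copy v, Act.inp t ready v, Act.out t copy v] T)
  | copy_in : DoubleBuffering s t ready copy v T
      (prepend [Act.inp s copy v, Act.inp t ready v, Act.out t copy v] T)
      (prepend [Act.inp s copy v, Act.inp t ready v, Act.out t copy v,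
        Act.inp s copy v, Act.inp t ready v, Act.out t copy v] T)
  | ready_in : DoubleBuffering s t ready copy v T
      (prepend [Act.inp t ready v, Act.out t copy v] T)
      (prepend [Act.inp t ready v, Act.out t copy v,
        Act.inp s copy v, Act.inp t ready v, Act.out t copy v] T)
  | copy_out : DoubleBuffering s t ready copy v T
      (prepend [Act.out t copy v] T)
      (prepend [Act.out t copy v, Act.inp s copy v, Act.inp t ready v, Act.out t copy v] T)

theorem DoubleBuffering.step {P L S : Type} {le : S → S → Prop} (hrefl : ∀ x : S, le x x)
    {s t : P} (hst : s ≠ t) {ready copy : L} {v : S} {T : SISO P L S}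
    (hT : T = prepend
      [Act.out s ready v, Act.inp s copy v, Act.inp t ready v, Act.out t copy v] T)
    {W W' : SISO P L S} (h : DoubleBuffering s t ready copy v T W W') :
    Step le (DoubleBuffering s t ready copy v T) W W' := by
  cases h with
  | start =>
    have h := Step.out (le := le) (p := s) (l := ready) (hrefl v)
      (ready_out (s := s) (t := t) (ready := ready) (copy := copy) (v := v) (T := T))
    rwa [show Stream'.Seq.cons (Act.out s ready v)
      (prepend [Act.inp s copy v, Act.inp t ready v, Act.out t copy v] T) = T from hT.symm] at h
  | ready_out =>
    have hB : BCtx s [Act.inp s copy v, Act.inp t ready v, Act.out t copy v] := by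
      simp [BCtx, hst.symm]
    have h := Step.ctxB (le := le) (l := ready)
      (W' := prepend [Act.inp s copy v, Act.inp t ready v, Act.out t copy v] T) (hrefl v) hB
      (copy_in (s := s) (t := t) (ready := ready) (copy := copy) (v := v) (T := T))
      (by ext x; simp only [prepend, List.foldr, acts_cons, Set.mem_insert_iff]; tauto)
    rwa [show Stream'.Seq.cons (Act.out s ready v)
      (prepend [Act.inp s copy v, Act.inp t ready v, Act.out t copy v] T) = T from hT.symm] at h
  | copy_in => exact .inp (hrefl v) ready_in
  | ready_in => exact .inp (hrefl v) copy_out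
  | copy_out => exact .out (hrefl v) ready_out

theorem stmt9 {P L S : Type} (le : S → S → Prop) (hrefl : ∀ x : S, le x x)
    (s t : P) (hst : s ≠ t) (ready copy : L) (v : S) :
    Refines le
      (Stream'.Seq.cons (Act.out s ready v)
        (Stream'.Seq.ofStream
          (Stream'.cycle
            [Act.out s ready v, Act.inp s copy v, Act.inp t ready v, Act.out t copy v]
            (by simp))))
      (Stream'.Seq.ofStream
        (Stream'.cycle
          [Act.out s ready v, Act.inp s copy v, Act.inp t ready v, Act.out t copy v]
          (by simp))) := by
  exact ⟨_, fun _ _ => DoubleBuffering.step hrefl hst (ofStream_cycle_eq_prepend _ _), .start⟩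
end
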